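/- Let ρ : ℂ^n → ℝ be a smooth (C^∞) function with ρ ≥ 0, such that ρ(z) = 0 if and only if Im z = 0, and such that at every point x ∈ ℝ^n the Hessian of ρ at x is positive definite transverse to ℝ^n, i.e. D²ρ(x)(i·b, i·b) > 0 for every b ∈ ℝ^n, b ≠ 0. Then for every compact set K ⊆ ℝ^n there exist an open neighborhood V of K in ℂ^n and a constant B > 0 such that the function √ρ + B·ρ is plurisubharmonic on V \ ℝ^n: for every z ∈ V with Im z ≠ 0 and every v ∈ ℂ^n, the Laplacian at t = 0 of t ↦ √(ρ(z + t·v)) + B·ρ(z + t·v) (t ranging over ℂ) is ≥ 0. -/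

import Mathlib

open Complex

/-- The componentwise imaginary part of a vector in `ℂ^n`, as a vector in `ℝ^n`. -/
noncomputable def imPart {n : ℕ} (z : EuclideanSpace ℂ (Fin n)) : EuclideanSpace ℝ (Fin n) :=
  (WithLp.equiv 2 (Fin n → ℝ)).symm fun k => (z k).im

/-- The purely imaginary vector `i·b ∈ ℂ^n` with imaginary part `b ∈ ℝ^n`. -/
noncomputable def iVec {n : ℕ} (b : EuclideanSpace ℝ (Fin n)) : EuclideanSpace ℂ (Fin n) :=
  (WithLp.equiv 2 (Fin n → ℂ)).symm fun k => Complex.I * (b k)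

/-- The Laplacian of `g : ℂ → ℝ` at `t`, viewing `ℂ ≅ ℝ²`: the sum of the second
derivatives in the directions `1` and `I`. -/
noncomputable def lap (g : ℂ → ℝ) (t : ℂ) : ℝ :=
  iteratedFDeriv ℝ 2 g t ![1, 1] + iteratedFDeriv ℝ 2 g t ![Complex.I, Complex.I]

theorem second_fderiv_comp_line {E : Type*} [NormedAddCommGroup E] [NormedSpace ℝ E]
    {ρ : E → ℝ} (hρ : ContDiff ℝ 2 ρ) (l : ℂ →L[ℝ] E) (z : E) (hz : 0 < ρ z) (B : ℝ) (e : ℂ) :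
    iteratedFDeriv ℝ 2 (fun t : ℂ => Real.sqrt (ρ (z + l t)) + B * ρ (z + l t)) 0 ![e, e] =
      (1 / (2 * Real.sqrt (ρ z)) + B) * fderiv ℝ (fderiv ℝ ρ) z (l e) (l e)
        - (fderiv ℝ ρ z (l e)) ^ 2 / (4 * Real.sqrt (ρ z) ^ 3) := by
  have hd : Differentiable ℝ ρ := hρ.differentiable (by norm_num)
  have hd2 : Differentiable ℝ (fderiv ℝ ρ) :=
    (hρ.fderiv_right (m := 1) (by norm_num)).differentiable (by norm_num)
  have hline (t : ℂ) : HasFDerivAt (fun t : ℂ => z + l t) l t := l.hasFDerivAt.const_add z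
  have h1 (t : ℂ) : HasFDerivAt (fun t : ℂ => ρ (z + l t)) ((fderiv ℝ ρ (z + l t)).comp l) t :=
    HasFDerivAt.comp t (hd (z + l t)).hasFDerivAt (hline t)
  have hpos : ∀ᶠ t : ℂ in nhds 0, 0 < ρ (z + l t) := by
    have : ContinuousAt (fun t : ℂ => ρ (z + l t)) 0 := (h1 0).continuousAt
    exact this.eventually_const_lt (by simpa using hz)
  have hfd : fderiv ℝ (fun t : ℂ => Real.sqrt (ρ (z + l t)) + B * ρ (z + l t)) =ᶠ[nhds 0]
      fun t => (1 / (2 * Real.sqrt (ρ (z + l t))) + B) • (fderiv ℝ ρ (z + l t)).comp l := by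
    filter_upwards [hpos] with t ht
    rw [add_smul]
    exact (((h1 t).sqrt ht.ne').add ((h1 t).const_mul B)).fderiv
  have h2 : HasFDerivAt (fun t : ℂ => (fderiv ℝ ρ (z + l t)).comp l)
      (((ContinuousLinearMap.compL ℝ ℂ E ℝ).flip l).comp
        ((fderiv ℝ (fderiv ℝ ρ) (z + l 0)).comp l)) 0 :=
    (((ContinuousLinearMap.compL ℝ ℂ E ℝ).flip l).hasFDerivAt).comp 0
      (HasFDerivAt.comp 0 (hd2 (z + l 0)).hasFDerivAt (hline 0))
  have hz0 : 0 < ρ (z + l 0) := by simpa using hz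
  have hs : 0 < Real.sqrt (ρ (z + l 0)) := Real.sqrt_pos.2 hz0
  have h3 : HasFDerivAt (fun t : ℂ => 1 / (2 * Real.sqrt (ρ (z + l t))) + B) _ 0 :=
    (((hasDerivAt_inv (mul_pos two_pos hs).ne').comp_hasFDerivAt (0 : ℂ)
      (((h1 0).sqrt hz0.ne').const_mul 2)).congr_of_eventuallyEq
        (Filter.Eventually.of_forall fun t => one_div _)).add_const B
  have h4 : HasFDerivAt
      (fun t : ℂ => (1 / (2 * Real.sqrt (ρ (z + l t))) + B) • (fderiv ℝ ρ (z + l t)).comp l) _ 0 :=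
    h3.smul h2
  rw [iteratedFDeriv_two_apply, hfd.fderiv_eq, h4.fderiv]
  simp at hs hz ⊢
  field_simp
  ring

theorem real_estimate {c C M y N S q L r s X B : ℝ} (hc : 0 < c) (hC : 0 ≤ C) (hM : 0 ≤ M)
    (hy : 0 ≤ y) (hy1 : y ≤ 1) (hyc : 4 * C * y ≤ c) (hs : 0 ≤ s) (hsr : s ^ 2 = r)
    (hSl : c * N ^ 2 ≤ S) (hSu : S ≤ 2 * M * N ^ 2) (hql : c * y ^ 2 ≤ q) (hqu : q ≤ M * y ^ 2)
    (hL : |L - S| ≤ 2 * C * y * N ^ 2) (hr : |r - q / 2| ≤ C * y ^ 3)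
    (hX : X ≤ q * S + (4 * M * C + 2 * C ^ 2) * y ^ 3 * N ^ 2)
    (hB : (10 * C * M + 6 * C ^ 2) / (2 * (Real.sqrt c / 2) ^ 3 * c) ≤ B) :
    X ≤ L * (2 * s ^ 2 + 4 * B * s ^ 3) := by
  obtain ⟨hL1, hL2⟩ := abs_le.1 hL
  obtain ⟨hr1, hr2⟩ := abs_le.1 hr
  have hk : 0 < Real.sqrt c / 2 := by positivity
  have hk2 : (Real.sqrt c / 2) ^ 2 = c / 4 := by rw [div_pow, Real.sq_sqrt hc.le]; norm_num
  set k := Real.sqrt c / 2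
  have hB0 : 0 ≤ B := le_trans (by positivity) hB
  rw [div_le_iff₀ (by positivity)] at hB
  have hLl : c * N ^ 2 / 2 ≤ L := by
    nlinarith [mul_le_mul_of_nonneg_right hyc (sq_nonneg N)]
  have hLu : L ≤ (2 * M + 2 * C) * N ^ 2 := by
    nlinarith [mul_le_mul_of_nonneg_right hy1 (mul_nonneg hC (sq_nonneg N))]
  have hL0 : 0 ≤ L := le_trans (by positivity) hLl
  have hky : k * y ≤ s := by
    refine abs_le_of_sq_le_sq' ?_ hs |>.2
    rw [mul_pow, hk2, hsr]
    nlinarith [mul_le_mul_of_nonneg_right hyc (sq_nonneg y)]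
  have hs3 : k ^ 3 * y ^ 3 ≤ s ^ 3 := by
    rw [← mul_pow]; gcongr
  have hq0 : 0 ≤ q := le_trans (by positivity) hql
  have h1 : L * (q - 2 * C * y ^ 3) ≤ L * (2 * s ^ 2) :=
    mul_le_mul_of_nonneg_left (by rw [hsr]; linarith) hL0
  have h2 : L * (2 * C * y ^ 3) ≤ (2 * M + 2 * C) * N ^ 2 * (2 * C * y ^ 3) :=
    mul_le_mul_of_nonneg_right hLu (by positivity)
  have h3 : (S - 2 * C * y * N ^ 2) * q ≤ L * q := mul_le_mul_of_nonneg_right (by linarith) hq0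
  have h4 : 2 * C * y * N ^ 2 * q ≤ 2 * C * y * N ^ 2 * (M * y ^ 2) :=
    mul_le_mul_of_nonneg_left hqu (by positivity)
  have h5 : (c * N ^ 2 / 2) * (4 * B * (k ^ 3 * y ^ 3)) ≤ L * (4 * B * s ^ 3) :=
    mul_le_mul hLl (by gcongr) (by positivity) hL0
  have h6 := mul_le_mul_of_nonneg_right hB (show 0 ≤ y ^ 3 * N ^ 2 by positivity)
  linarith

theorem taylor_of_lipschitz_second_fderiv {E : Type*} [NormedAddCommGroup E] [NormedSpace ℝ E]
    {ρ : E → ℝ} (hρ : ContDiff ℝ 2 ρ) {s : Set E} (hs : Convex ℝ s) {C : ℝ} (hC : 0 ≤ C)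
    {x z : E} (hx : x ∈ s) (hz : z ∈ s) (hx0 : ρ x = 0) (hx1 : fderiv ℝ ρ x = 0)
    (hlip : ∀ w ∈ s, ‖fderiv ℝ (fderiv ℝ ρ) w - fderiv ℝ (fderiv ℝ ρ) x‖ ≤ C * ‖w - x‖) :
    ‖fderiv ℝ ρ z - fderiv ℝ (fderiv ℝ ρ) x (z - x)‖ ≤ C * ‖z - x‖ ^ 2 ∧
      |ρ z - fderiv ℝ (fderiv ℝ ρ) x (z - x) (z - x) / 2| ≤ C * ‖z - x‖ ^ 3 := by
  have hd : Differentiable ℝ ρ := hρ.differentiable (by norm_num)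
  have hd2 : Differentiable ℝ (fderiv ℝ ρ) :=
    (hρ.fderiv_right (m := 1) (by norm_num)).differentiable (by norm_num)
  have hsymm : IsSymmSndFDerivAt ℝ ρ x := hρ.contDiffAt.isSymmSndFDerivAt (by simp)
  set A := fderiv ℝ (fderiv ℝ ρ) x with hA
  have key : ∀ w ∈ s, ‖fderiv ℝ ρ w - A (w - x)‖ ≤ C * ‖w - x‖ ^ 2 := by
    intro w hw
    have hseg : segment ℝ x w ⊆ s := hs.segment_subset hx hw
    have := (convex_segment x w).norm_image_sub_le_of_norm_hasFDerivWithin_le'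
      (f := fderiv ℝ ρ) (φ := A) (C := C * ‖w - x‖)
      (fun u _ => (hd2 u).hasFDerivAt.hasFDerivWithinAt)
      (fun u hu => (hlip u (hseg hu)).trans
        (mul_le_mul_of_nonneg_left (norm_sub_le_of_mem_segment hu) hC))
      (left_mem_segment ℝ x w) (right_mem_segment ℝ x w)
    rw [hx1, sub_zero] at this
    linarith
  refine ⟨key z hz, ?_⟩
  have hseg : segment ℝ x z ⊆ s := hs.segment_subset hx hz
  have hderiv : ∀ u, HasFDerivAt (fun w => ρ w - A (w - x) (w - x) / 2)
      (fderiv ℝ ρ u - A (u - x)) u := by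
    intro u
    have hsub : HasFDerivAt (fun w : E => w - x) (ContinuousLinearMap.id ℝ E) u :=
      (hasFDerivAt_id u).sub_const x
    have hq := ((A.hasFDerivAt.comp u hsub).clm_apply hsub).mul_const (1 / 2)
    refine ((hd u).hasFDerivAt.sub hq).congr_fderiv ?_ |>.congr_of_eventuallyEq ?_
    · ext e
      have := hsymm e (u - x)
      simp [← hA] at this ⊢
      linarith
    · exact Filter.Eventually.of_forall fun w => by simp [div_eq_mul_inv]
  have := (convex_segment x z).norm_image_sub_le_of_norm_hasFDerivWithin_le
      (C := C * ‖z - x‖ ^ 2)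
      (fun u _ => (hderiv u).hasFDerivWithinAt)
      (fun u hu => (key u (hseg hu)).trans
        (by gcongr; exact norm_sub_le_of_mem_segment hu))
      (left_mem_segment ℝ x z) (right_mem_segment ℝ x z)
  simp only [hx0, sub_self, map_zero, zero_div, sub_zero, Real.norm_eq_abs] at this
  linarith

theorem imPart_apply {n : ℕ} (z : EuclideanSpace ℂ (Fin n)) (k : Fin n) :
    imPart z k = (z k).im := rfl

theorem iVec_apply {n : ℕ} (b : EuclideanSpace ℝ (Fin n)) (k : Fin n) :
    iVec b k = Complex.I * (b k) := rfl

theorem norm_iVec {n : ℕ} (b : EuclideanSpace ℝ (Fin n)) : ‖iVec b‖ = ‖b‖ := by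
  simp [EuclideanSpace.norm_eq, iVec_apply]

theorem iVec_smul {n : ℕ} (t : ℝ) (b : EuclideanSpace ℝ (Fin n)) :
    iVec (t • b) = t • iVec b := by
  ext k
  simp [iVec_apply]
  ring

theorem continuous_iVec {n : ℕ} : Continuous (iVec (n := n)) := by
  unfold iVec
  simp only [WithLp.equiv_symm_apply]
  fun_prop

theorem imPart_sub {n : ℕ} (z w : EuclideanSpace ℂ (Fin n)) :
    imPart (z - w) = imPart z - imPart w := by
  ext k
  simp [imPart_apply]

theorem imPart_add_smul {n : ℕ} (z w : EuclideanSpace ℂ (Fin n)) (t : ℝ) :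
    imPart (z + t • w) = imPart z + t • imPart w := by
  ext k
  simp [imPart_apply]

theorem imPart_sub_iVec_imPart {n : ℕ} (z : EuclideanSpace ℂ (Fin n)) :
    imPart (z - iVec (imPart z)) = 0 := by
  ext k
  simp [imPart_apply, iVec_apply]

theorem norm_imPart_sq_add {n : ℕ} (v : EuclideanSpace ℂ (Fin n)) :
    ‖imPart v‖ ^ 2 + ‖imPart (Complex.I • v)‖ ^ 2 = ‖v‖ ^ 2 := by
  simp only [EuclideanSpace.norm_sq_eq, ← Finset.sum_add_distrib]
  refine Finset.sum_congr rfl fun k _ => ?_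
  simp [imPart_apply, Complex.sq_norm, Complex.normSq_apply]
  ring

theorem norm_imPart_le {n : ℕ} (v : EuclideanSpace ℂ (Fin n)) : ‖imPart v‖ ≤ ‖v‖ := by
  refine abs_le_of_sq_le_sq' ?_ (norm_nonneg _) |>.2
  nlinarith [norm_imPart_sq_add v, sq_nonneg ‖imPart (Complex.I • v)‖]

theorem exists_coercive {n : ℕ}
    (A : EuclideanSpace ℂ (Fin n) →L[ℝ] EuclideanSpace ℂ (Fin n) →L[ℝ] ℝ)
    (hA : ∀ b : EuclideanSpace ℝ (Fin n), b ≠ 0 → 0 < A (iVec b) (iVec b)) :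
    ∃ c > 0, ∀ b : EuclideanSpace ℝ (Fin n), c * ‖b‖ ^ 2 ≤ A (iVec b) (iVec b) := by
  have hcont : Continuous fun b : EuclideanSpace ℝ (Fin n) => A (iVec b) (iVec b) := by
    have := continuous_iVec (n := n)
    fun_prop
  obtain ⟨c, hc, h⟩ : ∃ c > 0, ∀ b ∈ Metric.sphere (0 : EuclideanSpace ℝ (Fin n)) 1,
      c ≤ A (iVec b) (iVec b) :=
    (isCompact_sphere _ _).exists_forall_le' hcont.continuousOn fun b hb => hA b (by
      rintro rfl; simp at hb)
  refine ⟨c, hc, fun b => ?_⟩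
  rcases eq_or_ne b 0 with rfl | hb
  · simpa using (show (0 : ℝ) ≤ A (iVec 0) (iVec 0) by
      have : iVec (0 : EuclideanSpace ℝ (Fin n)) = 0 := by simpa using iVec_smul 0 0
      simp [this])
  · have hn : ‖b‖ ≠ 0 := norm_ne_zero_iff.2 hb
    have := h (‖b‖⁻¹ • b) (by simp [norm_smul, hn])
    rw [iVec_smul] at this
    simp only [map_smul, _root_.smul_apply, smul_eq_mul] at this
    calc c * ‖b‖ ^ 2 ≤ (‖b‖⁻¹ * (‖b‖⁻¹ * A (iVec b) (iVec b))) * ‖b‖ ^ 2 := by gcongr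
      _ = _ := by field_simp

theorem fderiv_eq_zero_of_imPart_eq_zero {n : ℕ} {ρ : EuclideanSpace ℂ (Fin n) → ℝ}
    (hρ0 : ∀ z, 0 ≤ ρ z) (hvanish : ∀ z, ρ z = 0 ↔ imPart z = 0)
    {x : EuclideanSpace ℂ (Fin n)} (hx : imPart x = 0) : fderiv ℝ ρ x = 0 := by
  refine IsLocalMin.fderiv_eq_zero (Filter.Eventually.of_forall fun w => ?_)
  rw [(hvanish x).2 hx]
  exact hρ0 w

theorem second_fderiv_real_direction {n : ℕ} {ρ : EuclideanSpace ℂ (Fin n) → ℝ}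
    (hρ : ContDiff ℝ 2 ρ) (hρ0 : ∀ z, 0 ≤ ρ z) (hvanish : ∀ z, ρ z = 0 ↔ imPart z = 0)
    {x a : EuclideanSpace ℂ (Fin n)} (hx : imPart x = 0) (ha : imPart a = 0) :
    fderiv ℝ (fderiv ℝ ρ) x a = 0 := by
  have hd2 : Differentiable ℝ (fderiv ℝ ρ) :=
    (hρ.fderiv_right (m := 1) (by norm_num)).differentiable (by norm_num)
  have h := (hd2 x).hasFDerivAt.hasLineDerivAt a
  have hzero : (fun t : ℝ => fderiv ℝ ρ (x + t • a)) = fun _ => 0 := by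
    funext t
    exact fderiv_eq_zero_of_imPart_eq_zero hρ0 hvanish (by rw [imPart_add_smul, hx, ha]; simp)
  unfold HasLineDerivAt at h
  rw [hzero] at h
  exact h.unique (hasDerivAt_const _ _)

theorem second_fderiv_imPart {n : ℕ} {ρ : EuclideanSpace ℂ (Fin n) → ℝ}
    (hρ : ContDiff ℝ 2 ρ) (hρ0 : ∀ z, 0 ≤ ρ z) (hvanish : ∀ z, ρ z = 0 ↔ imPart z = 0)
    {x : EuclideanSpace ℂ (Fin n)} (hx : imPart x = 0) (w : EuclideanSpace ℂ (Fin n)) :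
    fderiv ℝ (fderiv ℝ ρ) x w w =
      fderiv ℝ (fderiv ℝ ρ) x (iVec (imPart w)) (iVec (imPart w)) := by
  have hsymm : IsSymmSndFDerivAt ℝ ρ x := hρ.contDiffAt.isSymmSndFDerivAt (by simp)
  have h := second_fderiv_real_direction hρ hρ0 hvanish hx (imPart_sub_iVec_imPart w)
  rw [map_sub, sub_eq_zero] at h
  rw [h, hsymm, h]

theorem lap_sqrt_add_nonneg {n : ℕ} {ρ : EuclideanSpace ℂ (Fin n) → ℝ} (hρ : ContDiff ℝ 2 ρ)
    {z : EuclideanSpace ℂ (Fin n)} (hz : 0 < ρ z) (v : EuclideanSpace ℂ (Fin n)) (B : ℝ)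
    (h : fderiv ℝ ρ z v ^ 2 + fderiv ℝ ρ z (Complex.I • v) ^ 2 ≤
      (fderiv ℝ (fderiv ℝ ρ) z v v +
        fderiv ℝ (fderiv ℝ ρ) z (Complex.I • v) (Complex.I • v)) *
        (2 * Real.sqrt (ρ z) ^ 2 + 4 * B * Real.sqrt (ρ z) ^ 3)) :
    0 ≤ lap (fun t : ℂ => Real.sqrt (ρ (z + t • v)) + B * ρ (z + t • v)) 0 := by
  have key := second_fderiv_comp_line hρ
    ((ContinuousLinearMap.toSpanSingleton ℂ v).restrictScalars ℝ) z hz B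
  simp only [ContinuousLinearMap.coe_restrictScalars',
    ContinuousLinearMap.toSpanSingleton_apply] at key
  rw [lap, key 1, key Complex.I, one_smul]
  have hs : 0 < Real.sqrt (ρ z) := Real.sqrt_pos.2 hz
  set s := Real.sqrt (ρ z)
  have := div_le_div_of_nonneg_right h (show 0 ≤ 4 * s ^ 3 by positivity)
  rw [← sub_nonneg] at this
  refine this.trans_eq ?_
  field_simp
  ring

theorem abs_sub_apply_apply_le {E : Type*} [NormedAddCommGroup E] [NormedSpace ℝ E]
    {H A : E →L[ℝ] E →L[ℝ] ℝ} {δ : ℝ} (h : ‖H - A‖ ≤ δ) (e : E) :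
    |H e e - A e e| ≤ δ * ‖e‖ ^ 2 := by
  have := (H - A).le_of_opNorm₂_le_of_le h (le_refl ‖e‖) (le_refl ‖e‖)
  simp only [_root_.sub_apply, Real.norm_eq_abs] at this
  linarith

theorem gradient_sq_le {E : Type*} [NormedAddCommGroup E] [NormedSpace ℝ E]
    {D A : E →L[ℝ] ℝ} {C M y : ℝ} (hC : 0 ≤ C) (hy : 0 ≤ y) (hy1 : y ≤ 1)
    (hD : ‖D - A‖ ≤ C * y ^ 2) (hA : ‖A‖ ≤ M * y) (e : E) :
    D e ^ 2 ≤ A e ^ 2 + (2 * M * C + C ^ 2) * y ^ 3 * ‖e‖ ^ 2 := by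
  have h1 := (D - A).le_of_opNorm_le hD e
  have h2 := A.le_of_opNorm_le hA e
  simp only [_root_.sub_apply, Real.norm_eq_abs] at h1 h2
  have h3 : |D e - A e| * (2 * |A e| + |D e - A e|) ≤
      (C * y ^ 2 * ‖e‖) * (2 * (M * y * ‖e‖) + C * y ^ 2 * ‖e‖) := by gcongr
  have h4 : D e ^ 2 - A e ^ 2 ≤ |D e - A e| * (2 * |A e| + |D e - A e|) := by
    nlinarith [le_abs_self ((D e - A e) * A e), abs_mul (D e - A e) (A e), sq_abs (D e - A e)]
  have h5 : C ^ 2 * y ^ 3 * ‖e‖ ^ 2 * y ≤ C ^ 2 * y ^ 3 * ‖e‖ ^ 2 * 1 :=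
    mul_le_mul_of_nonneg_left hy1 (by positivity)
  linarith

theorem exists_ball_second_fderiv_bounds {n : ℕ} {ρ : EuclideanSpace ℂ (Fin n) → ℝ}
    (hρ : ContDiff ℝ 3 ρ) {x₀ : EuclideanSpace ℂ (Fin n)}
    (hhess : ∀ b : EuclideanSpace ℝ (Fin n), b ≠ 0 →
      0 < fderiv ℝ (fderiv ℝ ρ) x₀ (iVec b) (iVec b)) :
    ∃ r > 0, ∃ c > 0, ∃ C ≥ 0, ∃ M ≥ 0,
      (∀ w ∈ Metric.ball x₀ r, ∀ u ∈ Metric.ball x₀ r,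
        ‖fderiv ℝ (fderiv ℝ ρ) w - fderiv ℝ (fderiv ℝ ρ) u‖ ≤ C * ‖w - u‖) ∧
      (∀ w ∈ Metric.ball x₀ r, ‖fderiv ℝ (fderiv ℝ ρ) w‖ ≤ M) ∧
      (∀ w ∈ Metric.ball x₀ r, ∀ b : EuclideanSpace ℝ (Fin n),
        c * ‖b‖ ^ 2 ≤ fderiv ℝ (fderiv ℝ ρ) w (iVec b) (iVec b)) ∧
      r ≤ 1 ∧ 4 * C * r ≤ c := by
  have hH : ContDiff ℝ 1 (fderiv ℝ (fderiv ℝ ρ)) :=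
    (hρ.fderiv_right (m := 2) (by norm_num)).fderiv_right (m := 1) (by norm_num)
  set H := fderiv ℝ (fderiv ℝ ρ)
  obtain ⟨C, t, ht, hlip⟩ := hH.contDiffAt (x := x₀) |>.exists_lipschitzOnWith
  obtain ⟨c, hc, hcoer⟩ := exists_coercive (H x₀) hhess
  obtain ⟨r₁, hr₁, hball₁⟩ := Metric.mem_nhds_iff.1 ht
  obtain ⟨r₂, hr₂, hball₂⟩ := Metric.continuousAt_iff.1 hH.continuous.continuousAt (c / 2)
    (half_pos hc)
  have hCpos : (0 : ℝ) < 8 * C + 1 := by positivity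
  refine ⟨min (min r₁ r₂) (min 1 (c / (8 * C + 1))), by positivity, c / 2, half_pos hc, C,
    C.coe_nonneg, ‖H x₀‖ + c / 2, by positivity, ?_, ?_, ?_, ?_, ?_⟩
  · intro w hw u hu
    simp only [Metric.mem_ball, lt_min_iff] at hw hu
    exact hlip.norm_sub_le (hball₁ hw.1.1) (hball₁ hu.1.1)
  · intro w hw
    simp only [Metric.mem_ball, lt_min_iff] at hw
    have := hball₂ hw.1.2
    rw [dist_eq_norm] at this
    linarith [norm_le_norm_add_norm_sub (H x₀) (H w), norm_sub_rev (H x₀) (H w)]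
  · intro w hw b
    simp only [Metric.mem_ball, lt_min_iff] at hw
    have h1 := hball₂ hw.1.2
    rw [dist_eq_norm] at h1
    have h2 := abs_le.1 (abs_sub_apply_apply_le h1.le (iVec b))
    rw [norm_iVec] at h2
    linarith [hcoer b]
  · exact (min_le_right _ _).trans (min_le_left _ _)
  · have h1 : min (min r₁ r₂) (min 1 (c / (8 * (C : ℝ) + 1))) ≤ c / (8 * C + 1) :=
      (min_le_right _ _).trans (min_le_right _ _)
    have h0 : 0 < min (min r₁ r₂) (min 1 (c / (8 * (C : ℝ) + 1))) := by positivity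
    rw [le_div_iff₀ hCpos] at h1
    linarith

theorem exists_nhds_psh {n : ℕ} {ρ : EuclideanSpace ℂ (Fin n) → ℝ}
    (hρ : ContDiff ℝ 3 ρ) (hρ0 : ∀ z, 0 ≤ ρ z) (hvanish : ∀ z, ρ z = 0 ↔ imPart z = 0)
    {x₀ : EuclideanSpace ℂ (Fin n)} (hx₀ : imPart x₀ = 0)
    (hhess : ∀ b : EuclideanSpace ℝ (Fin n), b ≠ 0 →
      0 < fderiv ℝ (fderiv ℝ ρ) x₀ (iVec b) (iVec b)) :
    ∃ V : Set (EuclideanSpace ℂ (Fin n)), IsOpen V ∧ x₀ ∈ V ∧ ∃ B₀ : ℝ, ∀ B ≥ B₀,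
      ∀ z ∈ V, imPart z ≠ 0 → ∀ v : EuclideanSpace ℂ (Fin n),
        0 ≤ lap (fun t : ℂ => Real.sqrt (ρ (z + t • v)) + B * ρ (z + t • v)) 0 := by
  have hρ2 : ContDiff ℝ 2 ρ := hρ.of_le (by norm_num)
  obtain ⟨r, hr, c, hc, C, hC, M, hM, hlip, hbound, hcoer, hr1, hrc⟩ :=
    exists_ball_second_fderiv_bounds hρ hhess
  refine ⟨Metric.ball x₀ (r / 2), Metric.isOpen_ball, Metric.mem_ball_self (half_pos hr),
    (10 * C * M + 6 * C ^ 2) / (2 * (Real.sqrt c / 2) ^ 3 * c), fun B hB z hz hzim v => ?_⟩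
  have hzpos : 0 < ρ z := lt_of_le_of_ne (hρ0 z) fun h => hzim ((hvanish z).1 h.symm)
  refine lap_sqrt_add_nonneg hρ2 hzpos v B ?_
  set x := z - iVec (imPart z) with hxdef
  have hx : imPart x = 0 := imPart_sub_iVec_imPart z
  have hzx : z - x = iVec (imPart z) := by rw [hxdef]; abel
  have hy : ‖z - x‖ = ‖imPart z‖ := by rw [hzx, norm_iVec]
  have hyz : ‖imPart z‖ ≤ ‖z - x₀‖ := by
    have := norm_imPart_le (z - x₀)
    rwa [imPart_sub, hx₀, sub_zero] at this
  rw [Metric.mem_ball, dist_eq_norm] at hz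
  have hzball : z ∈ Metric.ball x₀ r := by rw [Metric.mem_ball, dist_eq_norm]; linarith
  have hxball : x ∈ Metric.ball x₀ r := by
    rw [Metric.mem_ball, dist_eq_norm]
    linarith [norm_sub_le_norm_sub_add_norm_sub x z x₀, norm_sub_rev x z]
  have hyr : ‖z - x‖ ≤ r := by linarith
  obtain ⟨htay1, htay2⟩ := taylor_of_lipschitz_second_fderiv hρ2 (convex_ball x₀ r) hC
    hxball hzball ((hvanish x).2 hx) (fderiv_eq_zero_of_imPart_eq_zero hρ0 hvanish hx)
    (fun w hw => hlip w hw x hxball)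
  have hsymm : IsSymmSndFDerivAt ℝ ρ x := hρ2.contDiffAt.isSymmSndFDerivAt (by simp)
  have himp := second_fderiv_imPart hρ2 hρ0 hvanish hx
  have hHz := hlip z hzball x hxball
  have hAM := hbound x hxball
  have hAc := hcoer x hxball
  set A := fderiv ℝ (fderiv ℝ ρ) x
  have hApos : ∀ w, 0 ≤ A w w := fun w => by
    rw [himp]
    exact le_trans (by positivity) (hAc _)
  have hcs : ∀ u w, A u w ^ 2 ≤ A u u * A w w := fun u w => by
    have := LinearMap.BilinForm.apply_mul_apply_le_of_forall_zero_le A.toLinearMap₁₂ hApos u w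
    change A u w * A w u ≤ A u u * A w w at this
    rwa [hsymm.eq w u, ← sq] at this
  have hIv : ‖Complex.I • v‖ = ‖v‖ := by simp [norm_smul]
  have hAup : ∀ w, A w w ≤ M * ‖w‖ ^ 2 := fun w => by
    have := A.le_of_opNorm₂_le_of_le hAM (le_refl ‖w‖) (le_refl ‖w‖)
    linarith [Real.le_norm_self (A w w)]
  have hAy : ‖A (z - x)‖ ≤ M * ‖z - x‖ := A.le_of_opNorm_le hAM _
  have hy1 : ‖z - x‖ ≤ 1 := hyr.trans hr1
  refine real_estimate (c := c) (C := C) (M := M) (y := ‖z - x‖) (N := ‖v‖)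
    (S := A v v + A (Complex.I • v) (Complex.I • v)) (q := A (z - x) (z - x)) (r := ρ z)
    hc hC hM (norm_nonneg _) hy1
    (le_trans (by gcongr) hrc) (Real.sqrt_nonneg _) (Real.sq_sqrt hzpos.le) ?_ ?_ ?_ (hAup _)
    ?_ htay2 ?_ hB
  · rw [himp v, himp (Complex.I • v), ← norm_imPart_sq_add v]
    linarith [hAc (imPart v), hAc (imPart (Complex.I • v))]
  · have := hAup (Complex.I • v)
    rw [hIv] at this
    linarith [hAup v]
  · rw [hzx, norm_iVec]
    exact hAc _
  · have h1 := abs_sub_apply_apply_le hHz v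
    have h2 := abs_sub_apply_apply_le hHz (Complex.I • v)
    rw [hIv] at h2
    rw [abs_le] at h1 h2 ⊢
    constructor <;> linarith [h1.1, h1.2, h2.1, h2.2]
  · have h1 := gradient_sq_le hC (norm_nonneg _) hy1 htay1 hAy v
    have h2 := gradient_sq_le hC (norm_nonneg _) hy1 htay1 hAy (Complex.I • v)
    rw [hIv] at h2
    linarith [hcs (z - x) v, hcs (z - x) (Complex.I • v)]

/-- If `ρ : ℂ^n → ℝ` is smooth, nonnegative, vanishes exactly on `ℝ^n`, with Hessian
positive definite transverse to `ℝ^n` at each point of `ℝ^n`, then near any compact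
`K ⊆ ℝ^n` there is `B > 0` such that `√ρ + B·ρ` is plurisubharmonic off `ℝ^n`. -/
theorem stmt9 {n : ℕ} (ρ : EuclideanSpace ℂ (Fin n) → ℝ)
    (hρ : ContDiff ℝ (⊤ : ℕ∞) ρ) (hρ0 : ∀ z, 0 ≤ ρ z)
    (hvanish : ∀ z, ρ z = 0 ↔ imPart z = 0)
    (hhess : ∀ x : EuclideanSpace ℂ (Fin n), imPart x = 0 →
      ∀ b : EuclideanSpace ℝ (Fin n), b ≠ 0 →
        0 < iteratedFDeriv ℝ 2 ρ x ![iVec b, iVec b])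
    (K : Set (EuclideanSpace ℂ (Fin n))) (hK : IsCompact K)
    (hKreal : ∀ z ∈ K, imPart z = 0) :
    ∃ V : Set (EuclideanSpace ℂ (Fin n)), IsOpen V ∧ K ⊆ V ∧
      ∃ B > (0 : ℝ), ∀ z ∈ V, imPart z ≠ 0 → ∀ v : EuclideanSpace ℂ (Fin n),
        0 ≤ lap (fun t : ℂ => Real.sqrt (ρ (z + t • v)) + B * ρ (z + t • v)) 0 := by
  have hρ3 : ContDiff ℝ 3 ρ := contDiff_infty.1 hρ 3
  suffices h : ∃ V : Set (EuclideanSpace ℂ (Fin n)), IsOpen V ∧ K ⊆ V ∧ ∃ B₀ : ℝ, ∀ B ≥ B₀,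
      ∀ z ∈ V, imPart z ≠ 0 → ∀ v : EuclideanSpace ℂ (Fin n),
        0 ≤ lap (fun t : ℂ => Real.sqrt (ρ (z + t • v)) + B * ρ (z + t • v)) 0 by
    obtain ⟨V, hV, hKV, B₀, h⟩ := h
    exact ⟨V, hV, hKV, max B₀ 1, by positivity, h _ (le_max_left _ _)⟩
  refine hK.induction_on (p := fun s => ∃ V : Set (EuclideanSpace ℂ (Fin n)), IsOpen V ∧ s ⊆ V ∧
      ∃ B₀ : ℝ, ∀ B ≥ B₀, ∀ z ∈ V, imPart z ≠ 0 → ∀ v : EuclideanSpace ℂ (Fin n),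
        0 ≤ lap (fun t : ℂ => Real.sqrt (ρ (z + t • v)) + B * ρ (z + t • v)) 0) ?_ ?_ ?_ ?_
  · exact ⟨∅, isOpen_empty, subset_rfl, 0, fun _ _ _ hz => hz.elim⟩
  · rintro s t hst ⟨V, hV, htV, h⟩
    exact ⟨V, hV, hst.trans htV, h⟩
  · rintro s t ⟨V, hV, hsV, B₁, h₁⟩ ⟨W, hW, htW, B₂, h₂⟩
    refine ⟨V ∪ W, hV.union hW, Set.union_subset_union hsV htW, max B₁ B₂, ?_⟩
    rintro B hB z (hz | hz)
    · exact h₁ B ((le_max_left _ _).trans hB) z hz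
    · exact h₂ B ((le_max_right _ _).trans hB) z hz
  · intro x hx
    obtain ⟨V, hV, hxV, h⟩ := exists_nhds_psh hρ3 hρ0 hvanish (hKreal x hx) fun b hb => by
      simpa [iteratedFDeriv_two_apply] using hhess x (hKreal x hx) b hb
    exact ⟨V, mem_nhdsWithin_of_mem_nhds (hV.mem_nhds hxV), V, hV, subset_rfl, h⟩
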